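/- Let x̄ be a weak local minimizer of problem (P), with f and g Fréchet differentiable in a neighborhood of x̄ and twice Fréchet differentiable at x̄. Then for every critical direction u ∈ ℝ^s there exists a pair (λ,μ) ∈ Λ such that λ·∇f(x̄)u = 0, μ·∇g(x̄)u = 0, and [λ·∇²f(x̄) + μ·∇²g(x̄)](u,u) ≥ 0. -/

import Mathlib

open Filter Topology Pointwise

noncomputable section

/-- Euclidean dot product on `Fin n → ℝ`. -/
def dotp {n : ℕ} (a b : Fin n → ℝ) : ℝ := ∑ i, a i * b i

/-- Positive polar cone `C* = {l | l·x ≥ 0 for all x ∈ C}`. -/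
def polarCone {n : ℕ} (C : Set (Fin n → ℝ)) : Set (Fin n → ℝ) :=
  {l | ∀ x ∈ C, 0 ≤ dotp l x}

/-- A closed convex pointed cone with vertex at the origin. -/
def IsClosedConvexPointedCone {n : ℕ} (C : Set (Fin n → ℝ)) : Prop :=
  IsClosed C ∧ Convex ℝ C ∧ (0 : Fin n → ℝ) ∈ C ∧
    (∀ c : ℝ, 0 ≤ c → ∀ x ∈ C, c • x ∈ C) ∧ C ∩ (-C) ⊆ {0}

/-- The set Λ of normalized multiplier pairs. -/
def LambdaSet {n m : ℕ} (C : Set (Fin n → ℝ)) (K : Set (Fin m → ℝ)) :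
    Set ((Fin n → ℝ) × (Fin m → ℝ)) :=
  {p | p.1 ∈ polarCone C ∧ p.2 ∈ polarCone K ∧
    (∑ i, |p.1 i|) + (∑ j, |p.2 j|) = 1}

/-- `x̄` is a weak local minimizer of problem (P): no feasible point near `x̄`
has `f x ∈ f x̄ − int C`. -/
def WeakLocalMin {s n m : ℕ} (C : Set (Fin n → ℝ)) (K : Set (Fin m → ℝ))
    (X : Set (Fin s → ℝ)) (f : (Fin s → ℝ) → (Fin n → ℝ))
    (g : (Fin s → ℝ) → (Fin m → ℝ)) (xbar : Fin s → ℝ) : Prop :=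
  ∃ N ∈ 𝓝 xbar, ∀ x ∈ N, x ∈ X → g x ∈ -K →
    f x ∉ ({f xbar} : Set (Fin n → ℝ)) - interior C

/-- The auxiliary function `F(x) = sup{λ·(f x − f x̄) + μ·g x : (λ,μ) ∈ Λ}`. -/
def Ffun {s n m : ℕ} (C : Set (Fin n → ℝ)) (K : Set (Fin m → ℝ))
    (f : (Fin s → ℝ) → (Fin n → ℝ)) (g : (Fin s → ℝ) → (Fin m → ℝ))
    (xbar x : Fin s → ℝ) : ℝ :=
  sSup ((fun p => dotp p.1 (f x - f xbar) + dotp p.2 (g x)) '' LambdaSet C K)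

theorem dotp_add {n : ℕ} (l x y : Fin n → ℝ) : dotp l (x + y) = dotp l x + dotp l y := by
  simp [dotp, mul_add, Finset.sum_add_distrib]

theorem dotp_neg {n : ℕ} (l x : Fin n → ℝ) : dotp l (-x) = -dotp l x := by
  simp [dotp]

theorem dotp_smul {n : ℕ} (l : Fin n → ℝ) (c : ℝ) (x : Fin n → ℝ) :
    dotp l (c • x) = c * dotp l x := by
  simp [dotp, Finset.mul_sum, mul_left_comm]

theorem smul_dotp {n : ℕ} (c : ℝ) (l x : Fin n → ℝ) : dotp (c • l) x = c * dotp l x := by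
  simp [dotp, Finset.mul_sum, mul_assoc]

theorem zero_dotp {n : ℕ} (x : Fin n → ℝ) : dotp 0 x = 0 := by
  simp [dotp]

theorem continuous_dotp {n : ℕ} :
    Continuous fun q : (Fin n → ℝ) × (Fin n → ℝ) => dotp q.1 q.2 := by
  unfold dotp
  fun_prop

theorem Filter.Tendsto.dotp {α : Type*} {n : ℕ} {F : Filter α} {a b : α → Fin n → ℝ}
    {a₀ b₀ : Fin n → ℝ} (ha : Tendsto a F (𝓝 a₀)) (hb : Tendsto b F (𝓝 b₀)) :
    Tendsto (fun t => _root_.dotp (a t) (b t)) F (𝓝 (_root_.dotp a₀ b₀)) :=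
  (continuous_dotp.tendsto (a₀, b₀)).comp (ha.prodMk_nhds hb)

theorem exists_dotp_eq {n : ℕ} (φ : (Fin n → ℝ) →L[ℝ] ℝ) :
    ∃ l : Fin n → ℝ, ∀ x, dotp l x = φ x := by
  refine ⟨fun i => φ (Pi.single i 1), fun x => ?_⟩
  conv_rhs => rw [pi_eq_sum_univ' x, map_sum]
  simp [dotp, mul_comm]

theorem zero_mem_polarCone {n : ℕ} (C : Set (Fin n → ℝ)) : 0 ∈ polarCone C := by
  intro x _
  rw [zero_dotp]

theorem isClosed_polarCone {n : ℕ} (C : Set (Fin n → ℝ)) : IsClosed (polarCone C) := by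
  have h : polarCone C = ⋂ x ∈ C, {l | 0 ≤ dotp l x} := by
    ext l
    simp [polarCone]
  rw [h]
  refine isClosed_biInter fun x _ => isClosed_le continuous_const ?_
  unfold dotp
  fun_prop

/-- A linear functional bounded below on a cone is nonnegative on it. -/
theorem mem_polarCone_of_le {n : ℕ} {C : Set (Fin n → ℝ)} (hC : IsClosedConvexPointedCone C)
    {l : Fin n → ℝ} {c : ℝ} (h : ∀ x ∈ C, c ≤ dotp l x) : l ∈ polarCone C := by
  intro x hx
  by_contra! hlt
  have h0 : c ≤ 0 := by simpa [dotp] using h 0 hC.2.2.1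
  have hr : 0 ≤ (c - 1) / dotp l x := div_nonneg_of_nonpos (by linarith) hlt.le
  have := h _ (hC.2.2.2.1 _ hr x hx)
  rw [dotp_smul, div_mul_cancel₀ _ hlt.ne] at this
  linarith

theorem exists_polarCone_of_notMem_interior {n : ℕ} {C : Set (Fin n → ℝ)}
    (hC : IsClosedConvexPointedCone C) (hint : (interior C).Nonempty) {y : Fin n → ℝ}
    (hy : y ∉ interior C) : ∃ l ∈ polarCone C, l ≠ 0 ∧ dotp l y ≤ 0 := by
  obtain ⟨φ, hφ⟩ := geometric_hahn_banach_point_open hC.2.1.interior isOpen_interior hy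
  obtain ⟨l, hl⟩ := exists_dotp_eq φ
  have hle : ∀ x ∈ C, dotp l y ≤ dotp l x := by
    intro x hx
    have hx' : x ∈ closure (interior C) := by
      rw [hC.2.1.closure_interior_eq_closure_of_nonempty_interior hint]
      exact subset_closure hx
    have : closure (interior C) ⊆ {x | φ y ≤ φ x} :=
      closure_minimal (fun a ha => (hφ a ha).le) (isClosed_le continuous_const φ.continuous)
    simpa [hl] using this hx'
  refine ⟨l, mem_polarCone_of_le hC hle, ?_, ?_⟩
  · rintro rfl
    obtain ⟨a, ha⟩ := hint
    have := hφ a ha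
    rw [← hl, ← hl, zero_dotp, zero_dotp] at this
    exact this.false
  · simpa [dotp] using hle 0 hC.2.2.1

theorem exists_polarCone_of_notMem {n : ℕ} {C : Set (Fin n → ℝ)}
    (hC : IsClosedConvexPointedCone C) {y : Fin n → ℝ}
    (hy : y ∉ C) : ∃ l ∈ polarCone C, l ≠ 0 ∧ dotp l y ≤ 0 := by
  obtain ⟨φ, c, hc, hφ⟩ := geometric_hahn_banach_point_closed hC.2.1 hC.1 hy
  obtain ⟨l, hl⟩ := exists_dotp_eq φ
  have h0 := hφ 0 hC.2.2.1
  rw [map_zero] at h0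
  refine ⟨l, mem_polarCone_of_le hC fun x hx => (hl x).symm ▸ (hφ x hx).le, ?_, ?_⟩
  · rintro rfl
    have := hl y
    rw [zero_dotp] at this
    linarith
  · rw [hl]
    linarith

theorem sum_abs_pos {n : ℕ} {l : Fin n → ℝ} (hl : l ≠ 0) : 0 < ∑ i, |l i| := by
  obtain ⟨i, hi⟩ := Function.ne_iff.1 hl
  exact Finset.sum_pos' (fun _ _ => abs_nonneg _) ⟨i, Finset.mem_univ _, abs_pos.2 hi⟩

theorem inv_smul_mem_polarCone {n : ℕ} {C : Set (Fin n → ℝ)} {l : Fin n → ℝ} {r : ℝ}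
    (hl : l ∈ polarCone C) (hr : 0 < r) : r⁻¹ • l ∈ polarCone C := by
  intro x hx
  rw [smul_dotp]
  exact mul_nonneg (inv_nonneg.2 hr.le) (hl x hx)

theorem sum_abs_normalize {n : ℕ} {l : Fin n → ℝ} (hl : l ≠ 0) :
    ∑ i, |((∑ j, |l j|)⁻¹ • l) i| = 1 := by
  have h := sum_abs_pos hl
  simp only [Pi.smul_apply, smul_eq_mul, abs_mul, ← Finset.mul_sum]
  rw [abs_of_pos (inv_pos.2 h), inv_mul_cancel₀ h.ne']

/-- A pair outside `int C × K` is separated from it by a normalized multiplier pair. -/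
theorem exists_lambdaSet_dotp_nonpos {n m : ℕ} {C : Set (Fin n → ℝ)} {K : Set (Fin m → ℝ)}
    (hC : IsClosedConvexPointedCone C) (hK : IsClosedConvexPointedCone K)
    (hint : (interior C).Nonempty) {y : Fin n → ℝ} {z : Fin m → ℝ}
    (h : ¬ (z ∈ K ∧ y ∈ interior C)) :
    ∃ p ∈ LambdaSet C K, dotp p.1 y + dotp p.2 z ≤ 0 := by
  by_cases hz : z ∈ K
  · obtain ⟨l, hl, hl0, hly⟩ :=
      exists_polarCone_of_notMem_interior hC hint fun hy => h ⟨hz, hy⟩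
    have hpos := sum_abs_pos hl0
    refine ⟨((∑ j, |l j|)⁻¹ • l, 0),
      ⟨inv_smul_mem_polarCone hl hpos, zero_mem_polarCone K, ?_⟩, ?_⟩
    · dsimp only
      rw [sum_abs_normalize hl0]
      simp
    · rw [zero_dotp, smul_dotp, add_zero]
      exact mul_nonpos_of_nonneg_of_nonpos (inv_nonneg.2 hpos.le) hly
  · obtain ⟨l, hl, hl0, hlz⟩ := exists_polarCone_of_notMem hK hz
    have hpos := sum_abs_pos hl0
    refine ⟨(0, (∑ j, |l j|)⁻¹ • l),
      ⟨zero_mem_polarCone C, inv_smul_mem_polarCone hl hpos, ?_⟩, ?_⟩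
    · dsimp only
      rw [sum_abs_normalize hl0]
      simp
    · rw [zero_dotp, smul_dotp, zero_add]
      exact mul_nonpos_of_nonneg_of_nonpos (inv_nonneg.2 hpos.le) hlz

theorem isCompact_lambdaSet {n m : ℕ} (C : Set (Fin n → ℝ)) (K : Set (Fin m → ℝ)) :
    IsCompact (LambdaSet C K) := by
  refine (isCompact_closedBall (0 : (Fin n → ℝ) × (Fin m → ℝ)) 1).of_isClosed_subset ?_ ?_
  · exact ((isClosed_polarCone C).preimage continuous_fst).inter
      (((isClosed_polarCone K).preimage continuous_snd).inter
        (isClosed_eq (by fun_prop) continuous_const))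
  · rintro ⟨a, b⟩ ⟨-, -, h⟩
    dsimp only at h
    have ha : 0 ≤ ∑ i, |a i| := Finset.sum_nonneg fun _ _ => abs_nonneg _
    have hb : 0 ≤ ∑ j, |b j| := Finset.sum_nonneg fun _ _ => abs_nonneg _
    rw [mem_closedBall_zero_iff, Prod.norm_def, sup_le_iff]
    constructor <;> refine (pi_norm_le_iff_of_nonneg zero_le_one).2 fun i => ?_
    · have := Finset.single_le_sum (f := fun i => |a i|) (fun _ _ => abs_nonneg _)
        (Finset.mem_univ i)
      rw [Real.norm_eq_abs]
      linarith
    · have := Finset.single_le_sum (f := fun i => |b i|) (fun _ _ => abs_nonneg _)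
        (Finset.mem_univ i)
      rw [Real.norm_eq_abs]
      linarith

/-- Second-order Taylor expansion along a ray, for a function twice differentiable at the
base point only. -/
theorem tendsto_second_order_quotient {E F : Type*} [NormedAddCommGroup E] [NormedSpace ℝ E]
    [NormedAddCommGroup F] [NormedSpace ℝ F] {f : E → F} {f' : E → E →L[ℝ] F} {x : E}
    {f'' : E →L[ℝ] E →L[ℝ] F} (hf : ∀ᶠ y in 𝓝 x, HasFDerivAt f (f' y) y)
    (hf' : HasFDerivAt f' f'' x) (u : E) :
    Tendsto (fun t : ℝ => (t ^ 2)⁻¹ • (f (x + t • u) - f x - t • f' x u)) (𝓝[>] 0)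
      (𝓝 ((2⁻¹ : ℝ) • f'' u u)) := by
  have hline : ∀ t : ℝ, HasDerivAt (fun t : ℝ => x + t • u) u t := fun t => by
    simpa using ((hasDerivAt_id t).smul_const u).const_add x
  have hcont : Tendsto (fun t : ℝ => x + t • u) (𝓝 0) (𝓝 x) := by
    simpa using (hline 0).continuousAt.tendsto
  have hder : HasDerivAt (fun t : ℝ => f' (x + t • u) u) (f'' u u) 0 := by
    have h : HasDerivAt (fun t : ℝ => f' (x + t • u)) (f'' u) 0 := by
      refine HasFDerivAt.comp_hasDerivAt (0 : ℝ) ?_ (hline 0)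
      simpa using hf'
    simpa using h.clm_apply (hasDerivAt_const 0 u)
  rw [Metric.tendsto_nhds]
  intro ε hε
  have hlo := (hasDerivAt_iff_isLittleO.1 hder).def (half_pos hε)
  obtain ⟨δ, hδ, hball⟩ := Metric.eventually_nhds_iff.1 (hlo.and (hcont.eventually hf))
  filter_upwards [Ioo_mem_nhdsGT hδ] with t ht
  have hbound := norm_image_sub_le_of_norm_deriv_le_segment'
    (f := fun r : ℝ => f (x + r • u) - f x - r • f' x u - (r ^ 2 * 2⁻¹) • f'' u u)
    (f' := fun r : ℝ => f' (x + r • u) u - f' x u - r • f'' u u)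
    (a := 0) (b := t) (C := ε / 2 * t) ?_ ?_ t ⟨ht.1.le, le_rfl⟩
  · have ht2 : 0 < t ^ 2 := pow_pos ht.1 2
    have heq : (t ^ 2)⁻¹ • (f (x + t • u) - f x - t • f' x u) - (2⁻¹ : ℝ) • f'' u u =
        (t ^ 2)⁻¹ • (f (x + t • u) - f x - t • f' x u - (t ^ 2 * 2⁻¹) • f'' u u) := by
      rw [smul_sub _ _ ((t ^ 2 * 2⁻¹) • f'' u u), smul_smul, inv_mul_cancel_left₀ ht2.ne']
    simp only [zero_smul, add_zero, sub_self, sub_zero, zero_pow two_ne_zero, zero_mul]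
      at hbound
    rw [dist_eq_norm, heq, norm_smul, Real.norm_of_nonneg (inv_nonneg.2 ht2.le),
      inv_mul_lt_iff₀ ht2]
    nlinarith
  · intro r hr
    have hr' : dist r 0 < δ := by
      rw [Real.dist_eq, sub_zero, abs_of_nonneg hr.1]
      exact hr.2.trans_lt ht.2
    have h1 := (hball hr').2.comp_hasDerivAt r (hline r)
    have h2 : HasDerivAt (fun r : ℝ => r • f' x u) (f' x u) r := by
      simpa using (hasDerivAt_id r).smul_const (f' x u)
    have h3 : HasDerivAt (fun r : ℝ => (r ^ 2 * 2⁻¹) • f'' u u) (r • f'' u u) r := by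
      have h : HasDerivAt (fun r : ℝ => r ^ 2 * 2⁻¹) r r :=
        ((hasDerivAt_pow 2 r).mul_const (2⁻¹ : ℝ)).congr_deriv (by push_cast; ring)
      exact h.smul_const (f'' u u)
    exact (((h1.sub_const (f x)).sub h2).sub h3).hasDerivWithinAt
  · intro r hr
    have hr' : dist r 0 < δ := by
      rw [Real.dist_eq, sub_zero, abs_of_nonneg hr.1]
      exact hr.2.trans ht.2
    have h := (hball hr').1
    simp only [sub_zero, zero_smul, add_zero, Real.norm_of_nonneg hr.1] at h
    exact h.trans (mul_le_mul_of_nonneg_left hr.2.le (half_pos hε).le)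

theorem dotp_nonpos_of_mem_neg {n : ℕ} {C : Set (Fin n → ℝ)} {l x : Fin n → ℝ}
    (hl : l ∈ polarCone C) (hx : x ∈ -C) : dotp l x ≤ 0 := by
  have := hl (-x) hx
  rw [dotp_neg] at this
  linarith

theorem dotp_expand {n : ℕ} {t : ℝ} (ht : t ≠ 0) (l y y₀ v : Fin n → ℝ) :
    dotp l y = dotp l y₀ + t * dotp l v + t ^ 2 * dotp l ((t ^ 2)⁻¹ • (y - y₀ - t • v)) := by
  rw [← dotp_smul, ← dotp_smul, ← dotp_add, ← dotp_add, smul_inv_smul₀ (pow_ne_zero 2 ht)]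
  congr 1
  abel

/-- If `x̄` is a weak local minimizer of (P), `f`, `g` Fréchet differentiable near
`x̄` and twice Fréchet differentiable at `x̄`, then for every critical direction `u`
there is `(λ,μ) ∈ Λ` with `λ·∇f(x̄)u = 0`, `μ·∇g(x̄)u = 0` and
`[λ·∇²f(x̄) + μ·∇²g(x̄)](u,u) ≥ 0`. -/
theorem stmt_7 {s n m : ℕ}
    (C : Set (Fin n → ℝ)) (K : Set (Fin m → ℝ))
    (hC : IsClosedConvexPointedCone C) (hK : IsClosedConvexPointedCone K)
    (hCint : (interior C).Nonempty)
    (X : Set (Fin s → ℝ)) (hX : IsOpen X)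
    (f : (Fin s → ℝ) → (Fin n → ℝ)) (g : (Fin s → ℝ) → (Fin m → ℝ))
    (xbar : Fin s → ℝ) (hxX : xbar ∈ X) (hxfeas : g xbar ∈ -K)
    (hmin : WeakLocalMin C K X f g xbar)
    (Df : (Fin s → ℝ) → (Fin s → ℝ) →L[ℝ] (Fin n → ℝ))
    (Dg : (Fin s → ℝ) → (Fin s → ℝ) →L[ℝ] (Fin m → ℝ))
    (hDf : ∀ᶠ x in 𝓝 xbar, HasFDerivAt f (Df x) x)
    (hDg : ∀ᶠ x in 𝓝 xbar, HasFDerivAt g (Dg x) x)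
    (D2f : (Fin s → ℝ) →L[ℝ] (Fin s → ℝ) →L[ℝ] (Fin n → ℝ))
    (D2g : (Fin s → ℝ) →L[ℝ] (Fin s → ℝ) →L[ℝ] (Fin m → ℝ))
    (hD2f : HasFDerivAt Df D2f xbar) (hD2g : HasFDerivAt Dg D2g xbar) :
    ∀ u : Fin s → ℝ, Df xbar u ∈ -C → Dg xbar u ∈ -K →
      ∃ p ∈ LambdaSet C K,
        dotp p.1 (Df xbar u) = 0 ∧ dotp p.2 (Dg xbar u) = 0 ∧
        0 ≤ dotp p.1 (D2f u u) + dotp p.2 (D2g u u) := by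
  intro u huC huK
  obtain ⟨N, hN, hNmin⟩ := hmin
  have hline : Tendsto (fun t : ℝ => xbar + t • u) (𝓝[>] 0) (𝓝 xbar) := by
    have : ContinuousAt (fun t : ℝ => xbar + t • u) 0 := by fun_prop
    simpa using this.tendsto.mono_left nhdsWithin_le_nhds
  have hsep : ∀ᶠ t : ℝ in 𝓝[>] 0, ∃ p ∈ LambdaSet C K,
      dotp p.1 (-(f (xbar + t • u) - f xbar)) + dotp p.2 (-g (xbar + t • u)) ≤ 0 := by
    filter_upwards [hline hN, hline (hX.mem_nhds hxX)] with t htN htX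
    refine exists_lambdaSet_dotp_nonpos hC hK hCint fun h => hNmin _ htN htX h.1 ?_
    exact ⟨f xbar, rfl, _, h.2, by simp⟩
  have hchoose : ∃ p : ℝ → (Fin n → ℝ) × (Fin m → ℝ), ∀ᶠ t : ℝ in 𝓝[>] 0,
      p t ∈ LambdaSet C K ∧
      dotp (p t).1 (-(f (xbar + t • u) - f xbar)) + dotp (p t).2 (-g (xbar + t • u)) ≤ 0 :=
    hsep.choice
  obtain ⟨p, hp⟩ := hchoose
  set U : Ultrafilter ℝ := Ultrafilter.of (𝓝[>] 0)
  have hU : (U : Filter ℝ) ≤ 𝓝[>] 0 := Ultrafilter.of_le _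
  obtain ⟨q, hq, hlim⟩ := (isCompact_lambdaSet C K).ultrafilter_le_nhds' (U.map p)
    (hU (hp.mono fun t ht => ht.1))
  have hp1 : Tendsto (fun t => (p t).1) U (𝓝 q.1) := (continuous_fst.tendsto q).comp hlim
  have hp2 : Tendsto (fun t => (p t).2) U (𝓝 q.2) := (continuous_snd.tendsto q).comp hlim
  have hquad := (hp1.dotp ((tendsto_second_order_quotient hDf hD2f u).mono_left hU)).add
    (hp2.dotp ((tendsto_second_order_quotient hDg hD2g u).mono_left hU))
  have hlin := (hp1.dotp (tendsto_const_nhds (x := Df xbar u))).add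
    (hp2.dotp (tendsto_const_nhds (x := Dg xbar u)))
  have ht0 : Tendsto (fun t : ℝ => t) U (𝓝 0) := tendsto_id.mono_left (hU.trans nhdsWithin_le_nhds)
  have hkey : ∀ᶠ t : ℝ in U,
      0 ≤ (dotp (p t).1 (Df xbar u) + dotp (p t).2 (Dg xbar u)) + t *
        (dotp (p t).1 ((t ^ 2)⁻¹ • (f (xbar + t • u) - f xbar - t • Df xbar u)) +
          dotp (p t).2 ((t ^ 2)⁻¹ • (g (xbar + t • u) - g xbar - t • Dg xbar u))) := by
    filter_upwards [hU hp, hU self_mem_nhdsWithin] with t ht (htpos : 0 < t)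
    obtain ⟨hmem, hle⟩ := ht
    have hg := dotp_nonpos_of_mem_neg hmem.2.1 hxfeas
    rw [dotp_neg, dotp_neg, sub_eq_add_neg, dotp_add, dotp_neg,
      dotp_expand htpos.ne' _ (f (xbar + t • u)) (f xbar) (Df xbar u),
      dotp_expand htpos.ne' _ (g (xbar + t • u)) (g xbar) (Dg xbar u)] at hle
    refine (mul_nonneg_iff_of_pos_left htpos).1 ?_
    linarith
  have hlin0 := ge_of_tendsto (hlin.add (ht0.mul hquad)) hkey
  rw [zero_mul, add_zero] at hlin0
  have hf0 := dotp_nonpos_of_mem_neg hq.1 huC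
  have hg0 := dotp_nonpos_of_mem_neg hq.2.1 huK
  refine ⟨q, hq, by linarith, by linarith, ?_⟩
  have hquad0 := ge_of_tendsto hquad (b := 0) (by
    filter_upwards [hkey, hU hp, hU self_mem_nhdsWithin] with t hk ht (htpos : 0 < t)
    have h1 := dotp_nonpos_of_mem_neg ht.1.1 huC
    have h2 := dotp_nonpos_of_mem_neg ht.1.2.1 huK
    refine (mul_nonneg_iff_of_pos_left htpos).1 ?_
    linarith)
  rw [dotp_smul, dotp_smul] at hquad0
  linarith
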